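/- Let R be a commutative Noetherian ring, let I, 𝔞 ⊆ R be ideals with I ∩ R° ≠ ∅ and 𝔞 ∩ R° ≠ ∅, and let t ∈ ℚ with t > 0. Then Ī^{𝔞ᵗ} ⊆ (Ī : 𝔞ₜ) ⊆ Ī^{𝔞^{⌈t⌉}}, where 𝔞ₜ is the t-th rational power of 𝔞. -/

import Mathlib

open Ideal Filter
open scoped Pointwise

/-- `R°`: the set of elements of `R` not contained in any minimal prime of `R`. -/
def Rcirc (R : Type*) [CommRing R] : Set R :=
  {c | ∀ P ∈ minimalPrimes R, c ∉ P}

/-- The integral closure of an ideal `I`: elements satisfying an equation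
`x^n + r₁ x^{n-1} + ⋯ + rₙ = 0` with `rᵢ ∈ Iⁱ`. -/
def intCl {R : Type*} [CommRing R] (I : Ideal R) : Set R :=
  {x | ∃ n : ℕ, 0 < n ∧ ∃ r : ℕ → R,
    (∀ i, 1 ≤ i → i ≤ n → r i ∈ I ^ i) ∧
    x ^ n + ∑ i ∈ Finset.range n, r (i + 1) * x ^ (n - (i + 1)) = 0}

/-- The Hara–Yoshida `𝔞^t`-integral closure of `I`. -/
def HYIntCl {R : Type*} [CommRing R] (I a : Ideal R) (t : ℝ) : Set R :=
  {x | ∃ c ∈ Rcirc R, ∃ N : ℕ, ∀ n : ℕ, N ≤ n →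
    ∀ y ∈ a ^ ⌈t * (n : ℝ)⌉₊, c * x ^ n * y ∈ I ^ n}

/-- The Vraciu `𝔞^t`-integral closure of `I`. -/
def VIntCl {R : Type*} [CommRing R] (I a : Ideal R) (t : ℝ) : Set R :=
  {x | ∃ c ∈ Rcirc R, ∃ N : ℕ, ∀ n : ℕ, N ≤ n →
    ∀ y ∈ a ^ ⌈t * (n : ℝ)⌉₊, c * x ^ n * y ∈ a ^ ⌈t * (n : ℝ)⌉₊ * I ^ n}

/-- The `q`-th Frobenius bracket power `I^{[q]}`: the ideal generated by `q`-th powers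
of elements of `I`. -/
def fbp {R : Type*} [CommRing R] (I : Ideal R) (q : ℕ) : Ideal R :=
  Ideal.span ((fun x => x ^ q) '' (I : Set R))

/-- The Frobenius closure `I^F` (in characteristic `p`). -/
def frobCl {R : Type*} [CommRing R] (p : ℕ) (I : Ideal R) : Set R :=
  {x | ∃ e : ℕ, x ^ p ^ e ∈ fbp I (p ^ e)}

/-- The tight closure `I^*` (in characteristic `p`). -/
def tightCl {R : Type*} [CommRing R] (p : ℕ) (I : Ideal R) : Set R :=
  {x | ∃ c ∈ Rcirc R, ∃ E : ℕ, ∀ e : ℕ, E ≤ e → c * x ^ p ^ e ∈ fbp I (p ^ e)}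

/-- The Hara–Yoshida `𝔞^t`-Frobenius closure of `I`. -/
def HYFrobCl {R : Type*} [CommRing R] (p : ℕ) (I a : Ideal R) (t : ℝ) : Set R :=
  {x | ∃ E : ℕ, ∀ e : ℕ, E ≤ e →
    ∀ y ∈ a ^ ⌈t * (p : ℝ) ^ e⌉₊, x ^ p ^ e * y ∈ fbp I (p ^ e)}

/-- The Vraciu `𝔞^t`-Frobenius closure of `I`. -/
def VFrobCl {R : Type*} [CommRing R] (p : ℕ) (I a : Ideal R) (t : ℝ) : Set R :=
  {x | ∃ E : ℕ, ∀ e : ℕ, E ≤ e →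
    ∀ y ∈ a ^ ⌈t * (p : ℝ) ^ e⌉₊, x ^ p ^ e * y ∈ a ^ ⌈t * (p : ℝ) ^ e⌉₊ * fbp I (p ^ e)}

/-- The Hara–Yoshida `𝔞^t`-tight closure of `I`. -/
def HYTightCl {R : Type*} [CommRing R] (p : ℕ) (I a : Ideal R) (t : ℝ) : Set R :=
  {x | ∃ c ∈ Rcirc R, ∃ E : ℕ, ∀ e : ℕ, E ≤ e →
    ∀ y ∈ a ^ ⌈t * (p : ℝ) ^ e⌉₊, c * x ^ p ^ e * y ∈ fbp I (p ^ e)}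

/-- The Vraciu `𝔞^t`-tight closure of `I`. -/
def VTightCl {R : Type*} [CommRing R] (p : ℕ) (I a : Ideal R) (t : ℝ) : Set R :=
  {x | ∃ c ∈ Rcirc R, ∃ E : ℕ, ∀ e : ℕ, E ≤ e →
    ∀ y ∈ a ^ ⌈t * (p : ℝ) ^ e⌉₊, c * x ^ p ^ e * y ∈ a ^ ⌈t * (p : ℝ) ^ e⌉₊ * fbp I (p ^ e)}

/-- The `t`-th rational power of an ideal `𝔞`, for `t = num/den ∈ ℚ`. -/
def ratPow {R : Type*} [CommRing R] (a : Ideal R) (t : ℚ) : Set R :=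
  {x | x ^ t.den ∈ intCl (a ^ t.num.toNat)}

/-- `μ(𝔞)`: the minimal number of generators of the ideal `𝔞`. -/
noncomputable def mu {R : Type*} [CommRing R] (a : Ideal R) : ℕ :=
  sInf {m | ∃ s : Finset R, s.card = m ∧ Ideal.span (s : Set R) = a}

section

variable {R : Type*} [CommRing R]

theorem mul_mem_Rcirc {c d : R} (hc : c ∈ Rcirc R) (hd : d ∈ Rcirc R) : c * d ∈ Rcirc R :=
  fun P hP h => (hP.1.1.mem_or_mem h).elim (hc P hP) (hd P hP)

theorem pow_mem_Rcirc {c : R} (hc : c ∈ Rcirc R) (n : ℕ) : c ^ n ∈ Rcirc R :=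
  fun P hP h => hc P hP (hP.1.1.mem_of_pow_mem n h)

/-- An element annihilated by some `c ∈ R°` is nilpotent. -/
theorem isNilpotent_of_mul_eq_zero {c x : R} (hc : c ∈ Rcirc R) (h : c * x = 0) :
    IsNilpotent x := by
  rw [← mem_nilradical, nilradical, ← Ideal.sInf_minimalPrimes, Submodule.mem_sInf]
  intro P hP
  exact (hP.1.1.mem_or_mem (h ▸ P.zero_mem : c * x ∈ P)).resolve_left (hc P hP)

theorem mem_intCl_of_mem (J : Ideal R) {x : R} (hx : x ∈ J) : x ∈ intCl J := by
  refine ⟨1, one_pos, fun _ => -x, fun i h1 h2 => ?_, by simp⟩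
  obtain rfl : i = 1 := le_antisymm h2 h1
  simpa using hx

/-- Powers of an element of the integral closure of `J` lie in powers of `J`, up to a
bounded shift. -/
theorem exists_pow_mem_pow_sub {J : Ideal R} {x : R} (hx : x ∈ intCl J) :
    ∃ k : ℕ, ∀ n, x ^ n ∈ J ^ (n - k) := by
  obtain ⟨k, -, r, hr, h⟩ := hx
  refine ⟨k, fun n => ?_⟩
  induction n using Nat.strong_induction_on with
  | _ n ih =>
    rcases lt_or_ge n k with hnk | hnk
    · simp [Nat.sub_eq_zero_of_le hnk.le]
    · have hxn : x ^ n = -∑ i ∈ Finset.range k, r (i + 1) * x ^ (n - (i + 1)) := by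
        have hsplit : x ^ n = x ^ (n - k) * x ^ k := by rw [← pow_add]; congr 1; omega
        rw [hsplit, eq_neg_of_add_eq_zero_left h, mul_neg, Finset.mul_sum]
        congr 1
        refine Finset.sum_congr rfl fun i hi => ?_
        have hi := Finset.mem_range.1 hi
        rw [mul_left_comm, ← pow_add]
        congr 2
        omega
      rw [hxn]
      refine neg_mem (sum_mem fun i hi => ?_)
      have hi := Finset.mem_range.1 hi
      have hmem := Ideal.mul_mem_mul (hr (i + 1) (by omega) (by omega))
        (ih (n - (i + 1)) (by omega))
      rw [← pow_add] at hmem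
      exact Ideal.pow_le_pow_right (by omega) hmem

/-- Multiplying by a power of `d ∈ J` absorbs a bounded shift of exponent. -/
theorem pow_mul_mem_pow {J : Ideal R} {d z : R} (hd : d ∈ J) {k n : ℕ} (hz : z ∈ J ^ (n - k)) :
    d ^ k * z ∈ J ^ n := by
  have hmem := Ideal.mul_mem_mul (Ideal.pow_mem_pow hd k) hz
  rw [← pow_add] at hmem
  exact Ideal.pow_le_pow_right (by omega) hmem

/-- Powers of a finitely generated ideal inside the integral closure of `J` lie in powers
of `J`, up to a bounded shift. -/
theorem exists_pow_le_pow_sub {J K : Ideal R} (hK : K.FG) (h : (K : Set R) ⊆ intCl J) :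
    ∃ k : ℕ, ∀ n, K ^ n ≤ J ^ (n - k) := by
  induction K, hK using Submodule.fg_induction with
  | singleton x =>
    obtain ⟨k, hk⟩ := exists_pow_mem_pow_sub (h (Ideal.mem_span_singleton_self x))
    refine ⟨k, fun n => ?_⟩
    rw [Ideal.submodule_span_eq, Ideal.span_singleton_pow, Ideal.span_singleton_le_iff_mem]
    exact hk n
  | sup A B _ _ hA hB =>
    obtain ⟨k, hk⟩ := hA (subset_trans (SetLike.coe_subset_coe.2 le_sup_left) h)
    obtain ⟨l, hl⟩ := hB (subset_trans (SetLike.coe_subset_coe.2 le_sup_right) h)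
    refine ⟨k + l, fun n => ?_⟩
    change (A ⊔ B : Ideal R) ^ n ≤ _
    rw [← Ideal.add_eq_sup, add_pow, Ideal.sum_eq_sup]
    refine Finset.sup_le fun m hm => Ideal.mul_le_left.trans ?_
    have hm := Finset.mem_range.1 hm
    refine (Ideal.mul_mono (hk m) (hl (n - m))).trans ?_
    rw [← pow_add]
    exact Ideal.pow_le_pow_right (by omega)

/-- An element `w` with `w ^ (n + 1) ∈ I (I + (w)) ^ n` is integral over `I`. -/
theorem mem_intCl_of_pow_mem {I : Ideal R} {w : R} {n : ℕ}
    (h : w ^ (n + 1) ∈ I * (I ⊔ Ideal.span {w}) ^ n) : w ∈ intCl I := by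
  have hle : I * (I ⊔ Ideal.span {w}) ^ n ≤
      ⨆ i ∈ Finset.range (n + 1), I ^ (i + 1) * Ideal.span {w ^ (n - i)} := by
    rw [← Ideal.add_eq_sup, add_pow, Finset.mul_sum, Ideal.sum_eq_sup]
    refine Finset.sup_le fun i hi => ?_
    calc I * (I ^ i * Ideal.span {w} ^ (n - i) * (n.choose i : Ideal R))
        ≤ I * (I ^ i * Ideal.span {w} ^ (n - i)) := Ideal.mul_mono_right Ideal.mul_le_left
      _ = I ^ (i + 1) * Ideal.span {w ^ (n - i)} := by
          rw [pow_succ' I i, mul_assoc, Ideal.span_singleton_pow]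
      _ ≤ _ := le_iSup₂
          (f := fun j (_ : j ∈ Finset.range (n + 1)) => I ^ (j + 1) * Ideal.span {w ^ (n - j)}) i hi
  obtain ⟨μ, hμ⟩ := (Submodule.mem_iSup_finset_iff_exists_sum _ _).1 (hle h)
  choose s hs hsμ using fun i => Ideal.mem_mul_span_singleton.1 (μ i).2
  refine ⟨n + 1, n.succ_pos, fun i => -s (i - 1), fun i h1 _ => ?_, ?_⟩
  · have hmem := hs (i - 1)
    rw [Nat.sub_add_cancel h1] at hmem
    exact neg_mem hmem
  · rw [← hμ, ← Finset.sum_add_distrib]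
    refine Finset.sum_eq_zero fun i _ => ?_
    rw [← hsμ i]
    simp

/-- A multiplier `c ∈ R°` with `c wⁿ ∈ Iⁿ` for all `n` witnesses integrality of `w` over `I`. -/
theorem mem_intCl_of_forall_mul_pow_mem [IsNoetherianRing R] {I : Ideal R} {c w : R}
    (hc : c ∈ Rcirc R) (h : ∀ n, c * w ^ n ∈ I ^ n) : w ∈ intCl I := by
  set L : Ideal R := I ⊔ Ideal.span {w} with hL
  have hIL : I ≤ L := le_sup_left
  have hwL : w ∈ L := le_sup_right (a := I) (Ideal.mem_span_singleton_self w)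
  have hcL (n : ℕ) : Ideal.span {c} * L ^ n ≤ I ^ n := by
    rw [hL, ← Ideal.add_eq_sup, add_pow, Finset.mul_sum, Ideal.sum_eq_sup]
    refine Finset.sup_le fun i hi => ?_
    have hi := Finset.mem_range.1 hi
    calc Ideal.span {c} * (I ^ i * Ideal.span {w} ^ (n - i) * (n.choose i : Ideal R))
        ≤ Ideal.span {c} * (I ^ i * Ideal.span {w} ^ (n - i)) :=
          Ideal.mul_mono_right Ideal.mul_le_left
      _ = I ^ i * Ideal.span {c * w ^ (n - i)} := by
          rw [mul_left_comm, Ideal.span_singleton_pow, Ideal.span_singleton_mul_span_singleton]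
      _ ≤ I ^ i * I ^ (n - i) :=
          Ideal.mul_mono_right ((Ideal.span_singleton_le_iff_mem _).2 (h _))
      _ = I ^ n := by rw [← pow_add]; congr 1; omega
  let F : I.Filtration R :=
    { N := fun n => Ideal.span {c} * L ^ n
      mono := fun n => Ideal.mul_mono_right (Ideal.pow_le_pow_right n.le_succ)
      smul_le := fun n => by
        rw [smul_eq_mul, mul_left_comm, pow_succ']
        exact Ideal.mul_mono_right (Ideal.mul_mono_left hIL) }
  have hF : F.Stable := by
    refine (I.stableFiltration_stable (⊤ : Ideal R)).of_le fun n => ?_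
    change Ideal.span {c} * L ^ n ≤ I ^ n • ⊤
    simpa using hcL n
  obtain ⟨n, hn⟩ := hF
  have hn : I * (Ideal.span {c} * L ^ n) = Ideal.span {c} * L ^ (n + 1) := hn n le_rfl
  have hcw : c * w ^ (n + 1) ∈ Ideal.span {c} * (I * L ^ n) := by
    rw [mul_left_comm, hn]
    exact Ideal.mul_mem_mul (Ideal.mem_span_singleton_self c) (Ideal.pow_mem_pow hwL _)
  obtain ⟨q, hq, hcq⟩ := Ideal.mem_span_singleton_mul.1 hcw
  obtain ⟨m, hm⟩ := isNilpotent_of_mul_eq_zero hc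
    (show c * (w ^ (n + 1) - q) = 0 by rw [mul_sub, hcq, sub_self])
  have hm : (w ^ (n + 1) - q) ^ (m + 1) = 0 := by rw [pow_succ, hm, zero_mul]
  have hqL : q ∈ L ^ (n + 1) := by
    rw [pow_succ']
    exact Ideal.mul_mono_left hIL hq
  have key : w ^ ((n + 1) * m + n + 1) ∈ I * L ^ ((n + 1) * m + n) := by
    have hpow : w ^ ((n + 1) * m + n + 1) = (w ^ (n + 1)) ^ (m + 1) := by
      rw [← pow_mul]; congr 1
    have hgeom := (Commute.all (w ^ (n + 1)) (w ^ (n + 1) - q)).geom_sum₂_mul (m + 1)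
    rw [hm, sub_zero, sub_sub_cancel] at hgeom
    rw [hpow, ← hgeom, pow_add L, mul_left_comm]
    refine Ideal.mul_mem_mul (sum_mem fun i hi => ?_) hq
    have hi := Finset.mem_range.1 hi
    have hmem := Ideal.mul_mem_mul (Ideal.pow_mem_pow (Ideal.pow_mem_pow hwL (n + 1)) i)
      (Ideal.pow_mem_pow (sub_mem (Ideal.pow_mem_pow hwL (n + 1)) hqL) (m + 1 - 1 - i))
    rw [← pow_add, ← pow_mul] at hmem
    convert hmem using 3
    omega
  exact mem_intCl_of_pow_mem key

/-- If `c w ^ (d m) ∈ I ^ (d m)` for all large `m`, then `w` is integral over `I`. -/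
theorem mem_intCl_of_forall_mul_pow_mul_mem [IsNoetherianRing R] {I : Ideal R} {c e w : R}
    (hc : c ∈ Rcirc R) (he : e ∈ Rcirc R) (heI : e ∈ I) {d N : ℕ} (hd : 0 < d)
    (h : ∀ m, N ≤ m → c * w ^ (d * m) ∈ I ^ (d * m)) : w ∈ intCl I := by
  refine mem_intCl_of_forall_mul_pow_mem
    (mul_mem_Rcirc (pow_mem_Rcirc he (d * N + d)) hc) fun n => ?_
  rw [mul_assoc]
  apply pow_mul_mem_pow heI
  have hdiv := Nat.div_add_mod n d
  have hlt := Nat.mod_lt n hd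
  rcases lt_or_ge (n / d) N with hN | hN
  · have hle : d * (n / d) ≤ d * N := Nat.mul_le_mul_left d hN.le
    simp [show n - (d * N + d) = 0 by omega]
  · have hmem := Ideal.mul_mem_right (w ^ (n % d)) _ (h _ hN)
    rw [mul_assoc, ← pow_add, hdiv] at hmem
    exact Ideal.pow_le_pow_right (by omega) hmem

theorem mem_ratPow_of_mem_pow_ceil (a : Ideal R) (t : ℚ) {y : R} (hy : y ∈ a ^ ⌈t⌉₊) : y ∈ ratPow a t := by
  refine mem_intCl_of_mem _ ?_
  have hmem := Ideal.pow_mem_pow hy t.den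
  rw [← pow_mul] at hmem
  refine Ideal.pow_le_pow_right ?_ hmem
  rw [Int.toNat_le]
  have hle : t * t.den ≤ ⌈t⌉₊ * t.den := by gcongr; exact Nat.le_ceil t
  rw [Rat.mul_den_eq_num] at hle
  exact_mod_cast hle

end

theorem HY_integral_closure_rational_power {R : Type*} [CommRing R] [IsNoetherianRing R]
    (I a : Ideal R) (hI : ∃ c ∈ Rcirc R, c ∈ I) (ha : ∃ c ∈ Rcirc R, c ∈ a)
    (t : ℚ) (ht : 0 < t) :
    HYIntCl I a (t : ℝ) ⊆ {x | ∀ y ∈ ratPow a t, x * y ∈ intCl I} ∧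
    {x | ∀ y ∈ ratPow a t, x * y ∈ intCl I} ⊆ HYIntCl I a ((⌈t⌉₊ : ℝ)) := by
  obtain ⟨e, he, heI⟩ := hI
  obtain ⟨b, hb, hba⟩ := ha
  constructor
  · rintro x ⟨c, hc, N, hN⟩ y hy
    obtain ⟨k, hk⟩ := exists_pow_mem_pow_sub hy
    have hbk : (b ^ t.num.toNat) ^ k ∈ Rcirc R := pow_mem_Rcirc (pow_mem_Rcirc hb _) _
    refine mem_intCl_of_forall_mul_pow_mul_mem (mul_mem_Rcirc hc hbk) he heI t.den_pos
      (N := N) fun m hm => ?_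
    have hceil : ⌈(t : ℝ) * ((t.den * m : ℕ) : ℝ)⌉₊ = t.num.toNat * m := by
      have hnum : (t.num.toNat : ℚ) = t * t.den := by
        rw [Rat.mul_den_eq_num]
        exact_mod_cast Int.toNat_of_nonneg (Rat.num_pos.2 ht).le
      have heq : (t : ℝ) * ((t.den * m : ℕ) : ℝ) = ((t.num.toNat * m : ℕ) : ℝ) := by
        have : t * ((t.den * m : ℕ) : ℚ) = ((t.num.toNat * m : ℕ) : ℚ) := by
          push_cast
          rw [hnum, mul_assoc]
        exact_mod_cast this
      rw [heq, Nat.ceil_natCast]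
    have hy' := pow_mul_mem_pow (Ideal.pow_mem_pow hba t.num.toNat) (hk m)
    rw [← pow_mul a] at hy'
    have hmem := hN (t.den * m) (hm.trans (Nat.le_mul_of_pos_left m t.den_pos)) _
      (hceil ▸ hy')
    convert hmem using 1
    ring
  · intro x hx
    have hK : ((Ideal.span {x} * a ^ ⌈t⌉₊ : Ideal R) : Set R) ⊆ intCl I := by
      intro z hz
      obtain ⟨y, hy, rfl⟩ := Ideal.mem_span_singleton_mul.1 hz
      exact hx y (mem_ratPow_of_mem_pow_ceil a t hy)
    obtain ⟨k, hk⟩ := exists_pow_le_pow_sub (IsNoetherian.noetherian _) hK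
    refine ⟨e ^ k, pow_mem_Rcirc he k, 0, fun n _ y hy => ?_⟩
    rw [← Nat.cast_mul, Nat.ceil_natCast, pow_mul] at hy
    rw [mul_assoc]
    refine pow_mul_mem_pow heI (hk n ?_)
    rw [mul_pow]
    exact Ideal.mul_mem_mul (Ideal.pow_mem_pow (Ideal.mem_span_singleton_self x) n) hy
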